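/- arXiv:0905.0745 — 4 statements merged into one kernel-verified Lean document; each statement's English description precedes it below -/
import Mathlib

section
/- The minimum of ||R'|| over all left inverses R' of R exists and equals max_{1≤i≤s−1} |w_i|_C. (In the paper's notation, N(F) = max_{1≤i≤s−1} |w_i|_C.) -/
/-- The nondecreasing rearrangement of a tuple. -/
noncomputable def sortedVec {n : ℕ} (x : Fin n → ℝ) : Fin n → ℝ := x ∘ Tuple.sort x

/-- The center of a tuple `x`: its lower median, i.e. the value `y_l` with
`l = ⌊(n+1)/2⌋` (1-indexed) in the nondecreasing rearrangement `y_1 ≤ … ≤ y_n` of `x`. -/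
noncomputable def center {n : ℕ} (x : Fin n → ℝ) : ℝ :=
  if h : 0 < n then
    sortedVec x ⟨(n - 1) / 2, lt_of_le_of_lt (Nat.div_le_self _ _) (Nat.sub_lt h one_pos)⟩
  else 0

/-- The central norm `|x|_C = ∑_{i=1}^n |y_l - y_i|`. -/
noncomputable def centralNorm {n : ℕ} (x : Fin n → ℝ) : ℝ :=
  ∑ i, |center x - sortedVec x i|

/-- Row norm `‖A‖ = max_i ∑_j |a_{ij}|` of a real matrix. -/
noncomputable def rowNorm {m n : ℕ} (A : Matrix (Fin m) (Fin n) ℝ) : ℝ :=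
  ⨆ i, ∑ j, |A i j|

/-- `N(M)`: the infimum (in fact minimum) of the row norms of left inverses of `M`. -/
noncomputable def Nnorm {m n : ℕ} (M : Matrix (Fin m) (Fin n) ℝ) : ℝ :=
  sInf (rowNorm '' {M' : Matrix (Fin n) (Fin m) ℝ | M' * M = 1})

/-- Centralization of a row vector: subtract the center from each entry. -/
noncomputable def centralize {n : ℕ} (x : Fin n → ℝ) : Fin n → ℝ :=
  fun j => x j - center x

/-- Row-wise centralization of a matrix. -/
noncomputable def matCentralize {m n : ℕ} (B : Matrix (Fin m) (Fin n) ℝ) :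
    Matrix (Fin m) (Fin n) ℝ :=
  Matrix.of fun i => centralize (B i)

lemma median_sorted {n : ℕ} (y : Fin n → ℝ) (hy : Monotone y) (m : Fin n)
    (hm : (m : ℕ) = (n - 1) / 2) (c : ℝ) : ∑ i, |y m - y i| ≤ ∑ i, |y i - c| := by
  have h1 : ∑ i, |y m - y (Fin.rev i)| = ∑ i, |y m - y i| :=
    Equiv.sum_comp Fin.revPerm (fun i => |y m - y i|)
  have h2 : ∑ i, |y (Fin.rev i) - c| = ∑ i, |y i - c| :=
    Equiv.sum_comp Fin.revPerm (fun i => |y i - c|)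
  have key : ∑ i, (|y m - y i| + |y m - y (Fin.rev i)|)
      ≤ ∑ i, (|y i - c| + |y (Fin.rev i) - c|) := by
    refine Finset.sum_le_sum fun i _ => ?_
    have hr := Fin.val_rev i
    have hi := i.isLt
    rcases le_total (i : ℕ) (m : ℕ) with h | h
    · have a1 : y i ≤ y m := hy (Fin.le_def.2 h)
      have a2 : y m ≤ y (Fin.rev i) := hy (Fin.le_def.2 (by omega))
      rw [abs_of_nonneg (sub_nonneg.2 a1), abs_of_nonpos (sub_nonpos.2 a2)]
      have := neg_le_abs (y i - c)
      have := le_abs_self (y (Fin.rev i) - c)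
      linarith
    · rcases eq_or_lt_of_le h with h | h
      · have : i = m := Fin.ext h.symm
        subst this
        rw [sub_self, abs_zero, zero_add]
        have := abs_sub_le (y i) c (y (Fin.rev i))
        rw [abs_sub_comm c] at this
        exact this
      have a1 : y m ≤ y i := hy (Fin.le_def.2 h.le)
      have a2 : y (Fin.rev i) ≤ y m := hy (Fin.le_def.2 (by omega))
      rw [abs_of_nonpos (sub_nonpos.2 a1), abs_of_nonneg (sub_nonneg.2 a2)]
      have := le_abs_self (y i - c)
      have := neg_le_abs (y (Fin.rev i) - c)
      linarith
  rw [Finset.sum_add_distrib, Finset.sum_add_distrib, h1, h2] at key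
  linarith

lemma centralNorm_eq {n : ℕ} (x : Fin n → ℝ) : centralNorm x = ∑ i, |x i - center x| := by
  unfold centralNorm sortedVec
  rw [← Equiv.sum_comp (Tuple.sort x) (fun i => |x i - center x|)]
  exact Finset.sum_congr rfl fun i _ => abs_sub_comm _ _

lemma centralNorm_le {n : ℕ} (x : Fin n → ℝ) (c : ℝ) : centralNorm x ≤ ∑ i, |x i - c| := by
  rcases Nat.eq_zero_or_pos n with h | h
  · subst h
    simp [centralNorm]
  · rw [← Equiv.sum_comp (Tuple.sort x) (fun i => |x i - c|)]
    unfold centralNorm center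
    rw [dif_pos h]
    exact median_sorted (sortedVec x) (Tuple.monotone_sort x) _ rfl c

lemma top_det_ne {s : ℕ} (R : Matrix (Fin (s + 1)) (Fin s) ℝ)
    (hrank : R.rank = s) (hsum : ∀ j : Fin s, ∑ i : Fin (s + 1), R i j = 0) :
    IsUnit (R.submatrix Fin.castSucc id).det := by
  rw [isUnit_iff_ne_zero]
  intro hdet
  obtain ⟨v, hv, h0⟩ := Matrix.exists_mulVec_eq_zero_iff.2 hdet
  have hcs : ∀ i : Fin s, (R.mulVec v) i.castSucc = 0 := fun i => congrFun h0 i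
  have htot : ∑ i, (R.mulVec v) i = 0 := by
    simp only [Matrix.mulVec, dotProduct]
    rw [Finset.sum_comm]
    simp [← Finset.sum_mul, hsum]
  have hlast : (R.mulVec v) (Fin.last s) = 0 := by
    rw [Fin.sum_univ_castSucc] at htot
    simpa [hcs] using htot
  have hR : R.mulVec v = 0 := by
    funext i
    refine Fin.lastCases hlast hcs i
  have hk := LinearMap.finrank_range_add_finrank_ker R.mulVecLin
  have hr : Module.finrank ℝ (LinearMap.range R.mulVecLin) = s := hrank
  rw [hr, Module.finrank_fin_fun] at hk
  have hk0 : Module.finrank ℝ (LinearMap.ker R.mulVecLin) = 0 := by omega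
  have hb := Submodule.finrank_eq_zero.1 hk0
  have : v ∈ LinearMap.ker R.mulVecLin := by simpa using hR
  rw [hb] at this
  exact hv (by simpa using this)

/-- Proposition 2: the minimum of `‖R'‖` over all left inverses `R'` of `R` exists and
equals `max_{1 ≤ i ≤ s-1} |wᵢ|_C`, where `wᵢ = (w_{i,1}, …, w_{i,s-1}, 0)` and `(w_{i,j})`
is the inverse of the top square submatrix of `R`. -/
theorem stmt4 (s : ℕ) (hs : 1 ≤ s) (R : Matrix (Fin (s + 1)) (Fin s) ℝ)
    (hrank : R.rank = s) (hsum : ∀ j : Fin s, ∑ i : Fin (s + 1), R i j = 0) :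
    IsLeast (rowNorm '' {R' : Matrix (Fin s) (Fin (s + 1)) ℝ | R' * R = 1})
      (⨆ i : Fin s,
        centralNorm ((Fin.snoc ((R.submatrix Fin.castSucc id)⁻¹ i) (0 : ℝ) : Fin (s + 1) → ℝ))) := by
  have hdet := top_det_ne R hrank hsum
  set W := (R.submatrix Fin.castSucc id)⁻¹ with hW
  have hWR : W * R.submatrix Fin.castSucc id = 1 := Matrix.nonsing_inv_mul _ hdet
  haveI : Nonempty (Fin s) := ⟨⟨0, hs⟩⟩
  constructor
  · refine ⟨Matrix.of fun i j =>
      (Fin.snoc (W i) (0 : ℝ) : Fin (s + 1) → ℝ) j - center (Fin.snoc (W i) (0 : ℝ) : Fin (s + 1) → ℝ), ?_, ?_⟩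
    · show _ = _
      rw [← hWR]
      ext i k
      simp only [Matrix.mul_apply, Matrix.of_apply, sub_mul, Finset.sum_sub_distrib,
        ← Finset.mul_sum, hsum, mul_zero, sub_zero]
      rw [Fin.sum_univ_castSucc]
      simp
    · unfold rowNorm
      refine iSup_congr fun i => ?_
      rw [centralNorm_eq]
      rfl
  · rintro _ ⟨R', hR', rfl⟩
    have hR'1 : R' * R = 1 := hR'
    have hWeq : (Matrix.of fun i (j : Fin s) => R' i j.castSucc - R' i (Fin.last s)) = W := by
      have : (Matrix.of fun i (j : Fin s) => R' i j.castSucc - R' i (Fin.last s))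
          * R.submatrix Fin.castSucc id = 1 := by
        rw [← hR'1]
        ext i k
        have h := hsum k
        rw [Fin.sum_univ_castSucc] at h
        simp only [Matrix.mul_apply, Matrix.of_apply, sub_mul, Finset.sum_sub_distrib,
          ← Finset.mul_sum, Matrix.submatrix_apply, id]
        rw [Fin.sum_univ_castSucc]
        linear_combination (-R' i (Fin.last s)) * h
      rw [hW]
      exact (Matrix.inv_eq_left_inv this).symm
    unfold rowNorm
    refine ciSup_mono (Set.finite_range _).bddAbove fun i => ?_
    refine (centralNorm_le _ (-R' i (Fin.last s))).trans (le_of_eq ?_)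
    refine Finset.sum_congr rfl fun j _ => ?_
    congr 1
    refine Fin.lastCases ?_ (fun j => ?_) j
    · simp
    · rw [← hWeq]
      simp
end

section
/- For every real constant c > 0, there are only finitely many (s−1)×(s−1) integer matrices A with determinant ±1 such that N(R·A) ≤ c. (For any such unimodular A, the matrix R·A again has rank s−1 and zero column sums, so N(R·A) is defined; since fundamental systems of S-units correspond, up to roots of unity, to unimodular changes of basis F = F₀·A, this expresses the paper's Theorem 1: for any c > 0 there are only finitely many systems F of fundamental S-units, up to multiplication of the ε_i by roots of unity, with N(F) ≤ c.) -/
theorem exists_left_inv_aux {m n : ℕ} (R : Matrix (Fin m) (Fin n) ℝ) (h : R.rank = n) :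
    ∃ L : Matrix (Fin n) (Fin m) ℝ, L * R = 1 := by
  have hk : LinearMap.ker (Matrix.toLin' R) = ⊥ := by
    have h1 := LinearMap.finrank_range_add_finrank_ker (Matrix.toLin' R)
    have h2 : Module.finrank ℝ (LinearMap.range (Matrix.toLin' R)) = n := h
    rw [h2, Module.finrank_fin_fun] at h1
    exact Submodule.finrank_eq_zero.mp (by omega)
  obtain ⟨g, hg⟩ := (Matrix.toLin' R).exists_leftInverse_of_injective hk
  refine ⟨LinearMap.toMatrix' g, ?_⟩
  have := congrArg LinearMap.toMatrix' hg
  rwa [LinearMap.toMatrix'_comp, LinearMap.toMatrix'_toLin', LinearMap.toMatrix'_id] at this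

theorem entry_le_rowNorm_aux {m n : ℕ} (A : Matrix (Fin m) (Fin n) ℝ) (i : Fin m) (j : Fin n) :
    |A i j| ≤ rowNorm A :=
  (Finset.single_le_sum (f := fun j => |A i j|) (fun _ _ => abs_nonneg _) (Finset.mem_univ j)).trans
    (le_ciSup (f := fun i => ∑ j, |A i j|) (Set.finite_range _).bddAbove i)

theorem finite_bdd_aux (s : ℕ) (m : ℤ) :
    {B : Matrix (Fin s) (Fin s) ℤ | ∀ i j, |B i j| ≤ m}.Finite := by
  have h : {B : Fin s → Fin s → ℤ | ∀ i, B i ∈ {v : Fin s → ℤ | ∀ j, v j ∈ Set.Icc (-m) m}}.Finite :=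
    Set.Finite.pi' fun _ => Set.Finite.pi' fun _ => Set.finite_Icc _ _
  refine h.subset fun B hB i j => ?_
  exact abs_le.mp (hB i j)

/-- Theorem 1 (finiteness): for every `c > 0` there are only finitely many integer
unimodular matrices `A` with `N(R·A) ≤ c`. -/
theorem stmt5 (s : ℕ) (hs : 1 ≤ s) (R : Matrix (Fin (s + 1)) (Fin s) ℝ)
    (hrank : R.rank = s) (hsum : ∀ j : Fin s, ∑ i : Fin (s + 1), R i j = 0)
    (c : ℝ) (hc : 0 < c) :
    {A : Matrix (Fin s) (Fin s) ℤ | IsUnit A.det ∧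
      Nnorm (R * A.map (fun a : ℤ => (a : ℝ))) ≤ c}.Finite := by
  obtain ⟨L, hL⟩ := exists_left_inv_aux R hrank
  set K : ℝ := ∑ j, ∑ i, |R i j| with hK
  refine Set.Finite.of_finite_image (f := fun A => A⁻¹)
    ((finite_bdd_aux s ⌈(c + 1) * K⌉).subset ?_) ?_
  · rintro _ ⟨A, ⟨hA, hN⟩, rfl⟩ i j
    have hAB : A.map (fun a : ℤ => (a : ℝ)) * A⁻¹.map (fun a : ℤ => (a : ℝ)) = 1 := by
      have := congrArg (Int.castRingHom ℝ).mapMatrix (Matrix.mul_nonsing_inv A hA)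
      rw [map_mul, map_one] at this
      exact this
    have hBA := mul_eq_one_comm.mp hAB
    set A' := A.map (fun a : ℤ => (a : ℝ))
    set B' := A⁻¹.map (fun a : ℤ => (a : ℝ)) with hB'
    have hne : (rowNorm '' {M' : Matrix (Fin s) (Fin (s+1)) ℝ | M' * (R * A') = 1}).Nonempty := by
      refine ⟨_, B' * L, ?_, rfl⟩
      show B' * L * (R * A') = 1
      rw [Matrix.mul_assoc, ← Matrix.mul_assoc L, hL, Matrix.one_mul, hBA]
    obtain ⟨_, ⟨M, hM, rfl⟩, hMc⟩ := exists_lt_of_csInf_lt hne (lt_of_le_of_lt hN (lt_add_one c))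
    have hM' : M * R * A' = 1 := by rw [Matrix.mul_assoc]; exact hM
    have hMB : M * R = B' := by
      calc M * R = M * R * (A' * B') := by rw [hAB, Matrix.mul_one]
        _ = B' := by rw [← Matrix.mul_assoc, hM', Matrix.one_mul]
    have hb : |B' i j| ≤ (c + 1) * K := by
      rw [← hMB, Matrix.mul_apply]
      calc |∑ k, M i k * R k j| ≤ ∑ k, |M i k * R k j| := Finset.abs_sum_le_sum_abs _ _
        _ ≤ ∑ k, (c + 1) * |R k j| := by
            refine Finset.sum_le_sum fun k _ => ?_
            rw [abs_mul]
            exact mul_le_mul_of_nonneg_right ((entry_le_rowNorm_aux M i k).trans hMc.le)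
              (abs_nonneg _)
        _ = (c + 1) * ∑ k, |R k j| := by rw [Finset.mul_sum]
        _ ≤ (c + 1) * K := by
            refine mul_le_mul_of_nonneg_left ?_ (by linarith)
            exact Finset.single_le_sum (f := fun j => ∑ i, |R i j|)
              (fun _ _ => Finset.sum_nonneg fun _ _ => abs_nonneg _) (Finset.mem_univ j)
    have : ((|A⁻¹ i j| : ℤ) : ℝ) ≤ (⌈(c + 1) * K⌉ : ℤ) := by
      refine le_trans ?_ (Int.le_ceil _)
      rw [Int.cast_abs]
      exact hb
    exact_mod_cast this
  · rintro A ⟨hA, -⟩ B ⟨hB, -⟩ h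
    have h' : A⁻¹ = B⁻¹ := h
    rw [← Matrix.nonsing_inv_nonsing_inv A hA, h', Matrix.nonsing_inv_nonsing_inv B hB]
end

section
/- Let R' be any left inverse of R, and let A be an (s−1)×(s−1) integer matrix with determinant ±1 such that ||(A·R')^*|| < N(R). Then every row of A (viewed as a vector in ℝ^{s−1}) belongs to the convex hull of the 2s points ±N(R)·b_1, …, ±N(R)·b_s, where b_1, …, b_s ∈ ℝ^{s−1} are the rows of R. -/
/-- Lemma 3: if `R'` is a left inverse of `R` and `A` is an integer unimodular matrix
with `‖(A·R')^*‖ < N(R)`, then every row of `A` lies in the convex hull of the `2s`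
points `±N(R)·b₁, …, ±N(R)·b_s`, where `b₁, …, b_s` are the rows of `R`. -/
theorem stmt10 (s : ℕ) (hs : 1 ≤ s) (R : Matrix (Fin (s + 1)) (Fin s) ℝ)
    (hrank : R.rank = s) (hsum : ∀ j : Fin s, ∑ i : Fin (s + 1), R i j = 0)
    (R' : Matrix (Fin s) (Fin (s + 1)) ℝ) (hR' : R' * R = 1)
    (A : Matrix (Fin s) (Fin s) ℤ) (hA : IsUnit A.det)
    (h : rowNorm (matCentralize (A.map (fun a : ℤ => (a : ℝ)) * R')) < Nnorm R) :
    ∀ i : Fin s, (fun j => (A i j : ℝ)) ∈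
      convexHull ℝ {v : Fin s → ℝ | ∃ k : Fin (s + 1),
        v = Nnorm R • R k ∨ v = -(Nnorm R • R k)} := by
  intro i
  set N := Nnorm R with hN
  set B := A.map (fun a : ℤ => (a : ℝ)) * R' with hB
  set c : Fin (s + 1) → ℝ := matCentralize B i with hc
  have hle : ∑ k, |c k| ≤ rowNorm (matCentralize B) :=
    le_ciSup (f := fun i => ∑ j, |matCentralize B i j|) (Set.finite_range _).bddAbove i
  have hlt : ∑ k, |c k| < N := lt_of_le_of_lt hle h
  have hNpos : 0 < N := lt_of_le_of_lt (Finset.sum_nonneg fun k _ => abs_nonneg (c k)) hlt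
  have hBR : B * R = A.map (fun a : ℤ => (a : ℝ)) := by
    rw [hB, Matrix.mul_assoc, hR', Matrix.mul_one]
  have hcR : ∀ j, (A i j : ℝ) = ∑ k, c k * R k j := by
    intro j
    have h1 : (B * R) i j = (A i j : ℝ) := by rw [hBR]; rfl
    have h2 : ∀ k, c k = B i k - center (B i) := fun k => rfl
    rw [← h1, Matrix.mul_apply]
    simp only [h2, sub_mul, Finset.sum_sub_distrib, ← Finset.mul_sum, hsum j]
    simp
  set S : Set (Fin s → ℝ) := {v : Fin s → ℝ | ∃ k : Fin (s + 1),
        v = N • R k ∨ v = -(N • R k)} with hS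
  have hconv : Convex ℝ (convexHull ℝ S) := convex_convexHull ℝ S
  have hp : ∀ k, N • R k ∈ convexHull ℝ S := fun k =>
    subset_convexHull ℝ S ⟨k, Or.inl rfl⟩
  have hm : ∀ k, -(N • R k) ∈ convexHull ℝ S := fun k =>
    subset_convexHull ℝ S ⟨k, Or.inr rfl⟩
  have h0 : (0 : Fin s → ℝ) ∈ convexHull ℝ S := by
    have := hconv (hp 0) (hm 0) (a := 1 / 2) (b := 1 / 2) (by norm_num) (by norm_num)
      (by norm_num)
    simpa using this
  let w : Option (Fin (s + 1)) → ℝ := fun o => o.elim (1 - (∑ k, |c k|) / N) fun k => |c k| / N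
  let z : Option (Fin (s + 1)) → (Fin s → ℝ) := fun o =>
    o.elim 0 fun k => if 0 ≤ c k then N • R k else -(N • R k)
  have key := hconv.sum_mem (t := Finset.univ) (w := w) (z := z) ?_ ?_ ?_
  · convert key using 1
    ext j
    rw [hcR j, Fintype.sum_option]
    simp only [w, z, Option.elim, smul_zero, zero_add, Finset.sum_apply]
    refine Finset.sum_congr rfl fun k _ => ?_
    split_ifs with hk
    · simp only [Pi.smul_apply, smul_eq_mul, abs_of_nonneg hk]
      field_simp
    · simp only [Pi.smul_apply, Pi.neg_apply, smul_eq_mul, abs_of_neg (not_le.mp hk)]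
      field_simp
  · rintro (_ | k) _
    · simp only [w, Option.elim, sub_nonneg]
      exact (div_le_one hNpos).2 hlt.le
    · exact div_nonneg (abs_nonneg _) hNpos.le
  · rw [Fintype.sum_option]
    simp only [w, Option.elim, ← Finset.sum_div]
    ring
  · rintro (_ | k) _
    · exact h0
    · simp only [z, Option.elim]
      split_ifs
      · exact hp k
      · exact hm k
end

section
/- Let p be a prime, let s', n₀ ≥ 1, let u be a positive integer, let C₁ > 0, C₃ ∈ ℝ and X₀ > 0 be real numbers, and let κ_{j,i} ∈ ℤ_p (the p-adic integers) for 0 ≤ j ≤ s' and 0 ≤ i ≤ n₀−1. For γ ∈ ℤ_p let γ^{(u)} denote the unique integer with 0 ≤ γ^{(u)} ≤ p^u − 1 and γ ≡ γ^{(u)} (mod p^u). Let L ⊂ ℤ^{s'+n₀} be the set of integer linear combinations of the columns of the (s'+n₀)×(s'+n₀) matrix whose top-left s'×s' block is the identity, top-right s'×n₀ block is zero, bottom-left n₀×s' block has (i,j) entry κ_{j,i}^{(u)}, and bottom-right n₀×n₀ block is p^u times the identity; and let y ∈ ℤ^{s'+n₀} be the vector whose first s' entries are 0 and whose last n₀ entries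 are −κ_{0,0}^{(u)}, …, −κ_{0,n₀−1}^{(u)}. Define ℓ(L, y) as the minimum Euclidean norm of a nonzero element of L if y = 0, and as the minimum of ‖x − y‖ over x ∈ L otherwise. Let k_1, …, k_{s'} be integers, not all zero, let B be a real number with |k_j| ≤ B ≤ X₀ for all j, and suppose that ord_p(κ_{0,i} + Σ_{j=1}^{s'} k_j·κ_{j,i}) ≥ C₁B − C₃ for every i ∈ {0, …, n₀−1} (where ord_p is the p-adic valuation on ℤ_p, with ord_p(0) = +∞). If ℓ(L, y) > √(s')·X₀, then B < (u + C₃)/C₁. -/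
/-- The matrix `L` of the p-adic reduction lemma: top-left `s'×s'` identity block,
top-right zero block, bottom-left block with `(i,j)` entry `κ_{j,i}^{(u)}` (the residue
of `κ_{j,i}` mod `p^u`, for `j = 1, …, s'`), bottom-right `n₀×n₀` block `p^u·Id`. -/
noncomputable def redMat (p : ℕ) [Fact p.Prime] (s' n₀ u : ℕ)
    (κ : Fin (s' + 1) → Fin n₀ → ℤ_[p]) :
    Matrix (Fin (s' + n₀)) (Fin (s' + n₀)) ℤ :=
  Matrix.of fun idx jdx =>
    if _hi : (idx : ℕ) < s' then (if (idx : ℕ) = (jdx : ℕ) then 1 else 0)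
    else if hj : (jdx : ℕ) < s' then
      ((κ ⟨(jdx : ℕ) + 1, by omega⟩
          ⟨(idx : ℕ) - s', by have := idx.isLt; omega⟩).appr u : ℤ)
    else if (idx : ℕ) = (jdx : ℕ) then (p : ℤ) ^ u else 0

/-- The vector `y` of the p-adic reduction lemma: first `s'` entries `0`, last `n₀`
entries `-κ_{0,0}^{(u)}, …, -κ_{0,n₀-1}^{(u)}`. -/
noncomputable def redVec (p : ℕ) [Fact p.Prime] (s' n₀ u : ℕ)
    (κ : Fin (s' + 1) → Fin n₀ → ℤ_[p]) : Fin (s' + n₀) → ℤ :=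
  fun idx =>
    if _hi : (idx : ℕ) < s' then 0
    else -((κ 0 ⟨(idx : ℕ) - s', by have := idx.isLt; omega⟩).appr u : ℤ)

theorem aux_dvd (p : ℕ) [hp : Fact p.Prime] (s u : ℕ) (c : ℤ_[p]) (d : Fin s → ℤ_[p])
    (k : Fin s → ℤ)
    (h : c + ∑ j, (k j : ℤ_[p]) * d j = 0 ∨
      u ≤ (c + ∑ j, (k j : ℤ_[p]) * d j).valuation) :
    (p : ℤ) ^ u ∣ (c.appr u : ℤ) + ∑ j, k j * ((d j).appr u : ℤ) := by
  have h1 : c + ∑ j, (k j : ℤ_[p]) * d j ∈ (Ideal.span {(p : ℤ_[p]) ^ u}) := by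
    by_cases h0 : c + ∑ j, (k j : ℤ_[p]) * d j = 0
    · rw [h0]; exact Ideal.zero_mem _
    · rw [PadicInt.mem_span_pow_iff_le_valuation _ h0]
      exact h.resolve_left h0
  have h2 : (((c.appr u : ℤ) + ∑ j, k j * ((d j).appr u : ℤ) : ℤ) : ℤ_[p])
      ∈ (Ideal.span {(p : ℤ_[p]) ^ u}) := by
    have h3 : (c - (c.appr u : ℤ_[p])) + ∑ j, (k j : ℤ_[p]) * (d j - ((d j).appr u : ℤ_[p]))
        ∈ (Ideal.span {(p : ℤ_[p]) ^ u}) := by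
      refine Ideal.add_mem _ (PadicInt.appr_spec u c) (Ideal.sum_mem _ fun j _ => ?_)
      exact Ideal.mul_mem_left _ _ (PadicInt.appr_spec u (d j))
    have h4 := Ideal.sub_mem _ h1 h3
    convert h4 using 1
    push_cast
    simp only [mul_sub, Finset.sum_sub_distrib]
    ring
  rw [← PadicInt.norm_le_pow_iff_mem_span_pow, PadicInt.norm_int_le_pow_iff_dvd] at h2
  exact_mod_cast h2

theorem aux_top (p : ℕ) [hp : Fact p.Prime] (s n u : ℕ)
    (κ : Fin (s + 1) → Fin n → ℤ_[p]) (k : Fin s → ℤ) (m : Fin n → ℤ) (j : Fin s) :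
    (redMat p s n u κ).mulVec (Fin.append k m) (Fin.castAdd n j) = k j := by
  have h (x : Fin n) : (j : ℕ) ≠ s + x := by omega
  simp [Matrix.mulVec, dotProduct, Fin.sum_univ_add, redMat, h, Fin.val_inj]

theorem aux_bot (p : ℕ) [hp : Fact p.Prime] (s n u : ℕ)
    (κ : Fin (s + 1) → Fin n → ℤ_[p]) (k : Fin s → ℤ) (m : Fin n → ℤ) (i : Fin n) :
    (redMat p s n u κ).mulVec (Fin.append k m) (Fin.natAdd s i) =
      ∑ j, k j * ((κ j.succ i).appr u : ℤ) + (p : ℤ) ^ u * m i := by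
  simp [Matrix.mulVec, dotProduct, Fin.sum_univ_add, redMat, Fin.val_inj, mul_comm, Fin.succ]

/-- Lemma 5 (Smart's p-adic reduction lemma): with `L` the lattice generated by the
columns of `redMat` and `y = redVec`, if `ℓ(L, y) > √s'·X₀` (expressed by saying that
every relevant lattice vector has Euclidean norm `> √s'·X₀`), `|k_j| ≤ B ≤ X₀` and
`ord_p(κ_{0,i} + ∑_j k_j κ_{j,i}) ≥ C₁B - C₃` for all `i` (with `ord_p 0 = +∞`), then
`B < (u + C₃)/C₁`. -/
theorem stmt15 (p : ℕ) [hp : Fact p.Prime] (s' n₀ : ℕ) (hs' : 1 ≤ s') (hn₀ : 1 ≤ n₀)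
    (u : ℕ) (hu : 0 < u) (C₁ C₃ X₀ : ℝ) (hC₁ : 0 < C₁) (hX₀ : 0 < X₀)
    (κ : Fin (s' + 1) → Fin n₀ → ℤ_[p])
    (k : Fin s' → ℤ) (hk : k ≠ 0) (B : ℝ)
    (hkB : ∀ j, |(k j : ℝ)| ≤ B) (hBX₀ : B ≤ X₀)
    (hord : ∀ i : Fin n₀,
      κ 0 i + ∑ j : Fin s', (k j : ℤ_[p]) * κ j.succ i = 0 ∨
        C₁ * B - C₃ ≤
          (((κ 0 i + ∑ j : Fin s', (k j : ℤ_[p]) * κ j.succ i).valuation : ℤ) : ℝ))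
    (hlat : if redVec p s' n₀ u κ = 0 then
        ∀ a : Fin (s' + n₀) → ℤ, (redMat p s' n₀ u κ).mulVec a ≠ 0 →
          Real.sqrt s' * X₀ <
            Real.sqrt (∑ i, (((redMat p s' n₀ u κ).mulVec a) i : ℝ) ^ 2)
      else
        ∀ a : Fin (s' + n₀) → ℤ,
          Real.sqrt s' * X₀ <
            Real.sqrt (∑ i,
              ((((redMat p s' n₀ u κ).mulVec a) i - redVec p s' n₀ u κ i : ℤ) : ℝ) ^ 2)) :
    B < ((u : ℝ) + C₃) / C₁ := by
  by_contra hcon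
  rw [not_lt, div_le_iff₀ hC₁] at hcon
  have hd : ∀ i : Fin n₀, (p : ℤ) ^ u ∣
      ((κ 0 i).appr u : ℤ) + ∑ j : Fin s', k j * ((κ j.succ i).appr u : ℤ) := by
    intro i
    refine aux_dvd p s' u (κ 0 i) (fun j => κ j.succ i) k ((hord i).imp id fun h => ?_)
    have : (u : ℝ) ≤ (((κ 0 i + ∑ j : Fin s', (k j : ℤ_[p]) * κ j.succ i).valuation : ℤ) : ℝ) := by
      linarith
    exact_mod_cast this
  choose m hm using hd
  have htop := aux_top p s' n₀ u κ k (fun i => - m i)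
  have hyt : ∀ j : Fin s', redVec p s' n₀ u κ (Fin.castAdd n₀ j) = 0 := by
    intro j; simp [redVec]
  have hbot : ∀ i : Fin n₀, (redMat p s' n₀ u κ).mulVec (Fin.append k (fun i => - m i))
      (Fin.natAdd s' i) = redVec p s' n₀ u κ (Fin.natAdd s' i) := by
    intro i
    rw [aux_bot]
    have : redVec p s' n₀ u κ (Fin.natAdd s' i) = -((κ 0 i).appr u : ℤ) := by simp [redVec]
    rw [this]
    linarith [hm i]
  have hmain : Real.sqrt s' * X₀ < Real.sqrt (∑ i,
      ((((redMat p s' n₀ u κ).mulVec (Fin.append k (fun i => - m i))) i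
        - redVec p s' n₀ u κ i : ℤ) : ℝ) ^ 2) := by
    split_ifs at hlat with hy
    · have := hlat (Fin.append k (fun i => - m i)) (fun h0 => hk (funext fun j => by
        rw [← htop j, h0]; rfl))
      simpa [hy] using this
    · exact hlat _
  rw [Fin.sum_univ_add] at hmain
  simp only [htop, hyt, hbot, sub_self, sub_zero, Int.cast_zero] at hmain
  have hle : ∑ j : Fin s', (k j : ℝ) ^ 2 ≤ s' * X₀ ^ 2 := by
    calc ∑ j : Fin s', (k j : ℝ) ^ 2 ≤ ∑ j : Fin s', X₀ ^ 2 :=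
          Finset.sum_le_sum fun j _ => by
            rw [← sq_abs]
            exact pow_le_pow_left₀ (abs_nonneg _) ((hkB j).trans hBX₀) 2
      _ = s' * X₀ ^ 2 := by simp
  have h5 : Real.sqrt (s' * X₀ ^ 2) = Real.sqrt s' * X₀ := by
    rw [Real.sqrt_mul (by positivity), Real.sqrt_sq hX₀.le]
  have h6 := Real.sqrt_le_sqrt hle
  rw [h5] at h6
  simp at hmain
  linarith
end
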